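/- No simple poles for Weierstrass data with real periods: Let n ≥ 1 and let f₁, …, f_n be complex-valued functions that are holomorphic on the punctured disk S = {z ∈ ℂ : 0 < |z| < 1} and satisfy Σ_{i=1}^{n} f_i(z)² = 0 for all z ∈ S. Suppose each f_i has at worst a simple pole at 0, i.e., there are complex numbers c_i and functions g_i holomorphic on the full disk {|z| < 1} with f_i(z) = c_i/z + g_i(z) on S. If moreover for each i the real part of the circle integral ∮_{|z|=r} f_i(z) dz vanishes for some radius r ∈ (0,1), then c_i = 0 for every i; that is, each f_i extends holomorphically across 0. -/

import Mathlib

/-- No simple poles for Weierstrass data with real periods (key step of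
Proposition 2.17, Chern–Osserman): if f₁,…,f_n are holomorphic on the punctured
unit disk, satisfy Σ f_i² = 0, have at worst simple poles at 0 (f_i = c_i/z + g_i
with g_i holomorphic on the disk), and the real part of some circle integral
∮_{|z|=r} f_i dz vanishes for each i, then every c_i = 0. -/
theorem stmt_13 (n : ℕ) (hn : 1 ≤ n) (f : Fin n → ℂ → ℂ) (c : Fin n → ℂ)
    (g : Fin n → ℂ → ℂ)
    (hg : ∀ i, DifferentiableOn ℂ (g i) (Metric.ball (0 : ℂ) 1))
    (hf : ∀ i, ∀ z ∈ Metric.ball (0 : ℂ) 1 \ {0}, f i z = c i / z + g i z)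
    (hfh : ∀ i, DifferentiableOn ℂ (f i) (Metric.ball (0 : ℂ) 1 \ {0}))
    (hiso : ∀ z ∈ Metric.ball (0 : ℂ) 1 \ {0}, ∑ i, (f i z) ^ 2 = 0)
    (hper : ∀ i, ∃ r : ℝ, 0 < r ∧ r < 1 ∧ (circleIntegral (f i) 0 r).re = 0) :
    ∀ i, c i = 0 := by
  have him : ∀ i, (c i).im = 0 := by
    intro i
    obtain ⟨r, hr0, hr1, hre⟩ := hper i
    have hsub : Metric.closedBall (0 : ℂ) r ⊆ Metric.ball 0 1 := Metric.closedBall_subset_ball hr1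
    have hd : DifferentiableOn ℂ (fun z => c i + z * g i z) (Metric.closedBall (0 : ℂ) r) :=
      (differentiableOn_const _).add (differentiableOn_id.mul ((hg i).mono hsub))
    have hC := hd.circleIntegral_sub_inv_smul (Metric.mem_ball_self hr0)
    have hE : circleIntegral (f i) 0 r
        = circleIntegral (fun z => (z - 0)⁻¹ • (c i + z * g i z)) 0 r := by
      apply circleIntegral.integral_congr hr0.le
      intro z hz
      have hz0 : z ≠ 0 := by
        rintro rfl
        simp at hz
        exact hr0.ne hz
      have := hf i z ⟨hsub (Metric.sphere_subset_closedBall hz), hz0⟩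
      simp only [this, sub_zero, smul_eq_mul]
      field_simp
    rw [hE, hC] at hre
    simpa [Real.pi_ne_zero] using hre
  have hsum : ∑ i, (c i) ^ 2 = 0 := by
    have hcont : ContinuousAt (fun z : ℂ => ∑ i, (c i + z * g i z) ^ 2) 0 := by
      have hgi : ∀ i, ContinuousAt (g i) 0 := fun i =>
        ((hg i).differentiableAt (Metric.ball_mem_nhds _ one_pos)).continuousAt
      exact tendsto_finsetSum _ fun i _ =>
        (continuousAt_const.add (continuousAt_id.mul (hgi i))).pow 2
    have h1 : Filter.Tendsto (fun z : ℂ => ∑ i, (c i + z * g i z) ^ 2)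
        (nhdsWithin 0 {0}ᶜ) (nhds (∑ i, (c i) ^ 2)) := by
      have := hcont.tendsto.mono_left (nhdsWithin_le_nhds (s := {0}ᶜ))
      simpa using this
    refine tendsto_nhds_unique_of_eventuallyEq h1 tendsto_const_nhds ?_
    filter_upwards [self_mem_nhdsWithin,
      mem_nhdsWithin_of_mem_nhds (Metric.ball_mem_nhds (0 : ℂ) one_pos)] with z hz hzb
    have hz0 : z ≠ 0 := hz
    have h2 := hiso z ⟨hzb, hz0⟩
    have h3 : ∀ i, c i + z * g i z = z * f i z := by
      intro i
      rw [hf i z ⟨hzb, hz0⟩]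
      field_simp
    simp only [h3, mul_pow, ← Finset.mul_sum, h2, mul_zero]
  have hre : ∑ i, (c i).re ^ 2 = 0 := by
    have := congrArg Complex.re hsum
    simpa [pow_two, him] using this
  intro i
  have := (Finset.sum_eq_zero_iff_of_nonneg (fun i _ => sq_nonneg (c i).re)).1 hre i
    (Finset.mem_univ i)
  exact Complex.ext (by simpa using this) (him i)
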